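/- arXiv:1612.05435 — 4 statements merged into one kernel-verified Lean document; each statement's English description precedes it below -/
import Mathlib

section
/- Let H and P be symmetric positive definite N×N real matrices and let δ > 0 be such that the matrix I − (δ/2)·P⁻¹H is invertible (e.g. (δ/2)·‖P⁻¹H‖ < 1). Then the matrix C := (I − (δ/2)·P⁻¹H)⁻¹·H⁻¹ satisfies the discrete stationarity equation C = (I − δ·P⁻¹H)·C·(I − δ·H·P⁻¹) + 2δ·P⁻¹; equivalently, C = (H − (δ/2)·H·P⁻¹·H)⁻¹ is the covariance matrix of the Gaussian invariant measure of the Euler–Maruyama discretisation X_{n+1} = X_n − δ·P⁻¹·H·X_n + √(2δ)·P^{-1/2}·R_n of the preconditioned overdamped Langevin dynamics with quadratic energy E_N(x) = (1/2)·xᵀHx. -/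
/-- For symmetric positive definite `H, P` and a time-step `δ > 0` such that
`I - (δ/2) P⁻¹ H` is invertible, the matrix `C = (I - (δ/2) P⁻¹H)⁻¹ H⁻¹` satisfies the
discrete stationarity equation `C = (I - δ P⁻¹H) C (I - δ H P⁻¹) + 2δ P⁻¹` of the
Euler–Maruyama discretisation of the preconditioned overdamped Langevin dynamics
with quadratic energy `E_N(x) = ½ xᵀHx`. -/
theorem stmt0 (N : ℕ) (H P : Matrix (Fin N) (Fin N) ℝ)
    (hH : H.PosDef) (hP : P.PosDef) (δ : ℝ) (hδ : 0 < δ)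
    (hinv : IsUnit ((1 : Matrix (Fin N) (Fin N) ℝ) - (δ / 2) • (P⁻¹ * H)))
    (C : Matrix (Fin N) (Fin N) ℝ)
    (hC : C = ((1 : Matrix (Fin N) (Fin N) ℝ) - (δ / 2) • (P⁻¹ * H))⁻¹ * H⁻¹) :
    C = ((1 : Matrix (Fin N) (Fin N) ℝ) - δ • (P⁻¹ * H)) * C *
          ((1 : Matrix (Fin N) (Fin N) ℝ) - δ • (H * P⁻¹)) + (2 * δ) • P⁻¹ := by
  have hHdet : IsUnit H.det := hH.det_pos.ne'.isUnit
  have h1 : H * H⁻¹ = 1 := Matrix.mul_nonsing_inv H hHdet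
  have h2 : H⁻¹ * H = 1 := Matrix.nonsing_inv_mul H hHdet
  have hMdet := (Matrix.isUnit_iff_isUnit_det _).mp hinv
  have m1 := Matrix.mul_nonsing_inv _ hMdet
  have m2 := Matrix.nonsing_inv_mul _ hMdet
  generalize P⁻¹ = Q at *
  have F1 : C - (δ / 2) • (Q * H * C) = H⁻¹ := by
    have : (1 - (δ / 2) • (Q * H)) * C = H⁻¹ := by
      rw [hC, ← Matrix.mul_assoc, m1, Matrix.one_mul]
    rw [← this, Matrix.sub_mul, Matrix.one_mul, Matrix.smul_mul]
  have F2 : C - (δ / 2) • (C * (H * Q)) = H⁻¹ := by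
    have e : C * H * (1 - (δ / 2) • (Q * H)) = 1 := by
      have : C * H = (1 - (δ / 2) • (Q * H))⁻¹ := by
        rw [hC, Matrix.mul_assoc, h2, Matrix.mul_one]
      rw [this, m2]
    have e2 : C * H * (1 - (δ / 2) • (Q * H)) = (C - (δ / 2) • (C * (H * Q))) * H := by
      simp only [Matrix.mul_sub, Matrix.sub_mul, Matrix.mul_one, Matrix.mul_smul,
        Matrix.smul_mul, Matrix.mul_assoc]
    rw [e2] at e
    calc _ = (C - (δ / 2) • (C * (H * Q))) * H * H⁻¹ := by
          rw [Matrix.mul_assoc, h1, Matrix.mul_one]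
      _ = H⁻¹ := by rw [e, Matrix.one_mul]
  have F3 : Q * H * C - (δ / 2) • (Q * H * C * (H * Q)) = Q := by
    have : Q * H * (C - (δ / 2) • (C * (H * Q))) = Q := by
      rw [F2, Matrix.mul_assoc, h1, Matrix.mul_one]
    rw [Matrix.mul_sub, Matrix.mul_smul, ← Matrix.mul_assoc (Q * H) C] at this
    exact this
  have ex : (1 - δ • (Q * H)) * C * (1 - δ • (H * Q)) + (2 * δ) • Q
      = C - δ • (Q * H * C) - δ • (C * (H * Q))
        + (δ * δ) • (Q * H * C * (H * Q)) + (2 * δ) • Q := by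
    rw [Matrix.sub_mul, Matrix.one_mul, Matrix.smul_mul, Matrix.mul_sub, Matrix.mul_one,
      Matrix.mul_smul, Matrix.sub_mul, Matrix.smul_mul]
    module
  rw [ex]
  clear ex m1 m2 hMdet hinv hC
  generalize Q * H * C * (H * Q) = Z at *
  generalize Q * H * C = X at *
  generalize C * (H * Q) = Y at *
  ext i j
  have a := congrFun (congrFun F1 i) j
  have b := congrFun (congrFun F2 i) j
  have c := congrFun (congrFun F3 i) j
  simp only [Matrix.add_apply, Matrix.sub_apply, Matrix.smul_apply, smul_eq_mul] at a b c ⊢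
  linear_combination 2 * a - 2 * b + 2 * δ * c
end

section
/- Let H be a symmetric positive definite N×N real matrix, c₀ ∈ (0, 1], and suppose c₀|v|² ≤ vᵀHv ≤ |v|² for every v ∈ ℝ^N. Let l ∈ ℝ^N with |l| = 1 and K > 0, and set H_K := H + K·l·lᵀ. Then K²/(1+K)² ≤ K²·|H_K⁻¹ l|² ≤ 1/c₀². In particular, the asymptotic variance σ_f² = 2K²|H_K⁻¹l|² of the umbrella observable under the unpreconditioned Langevin dynamics is bounded above and below by positive constants independent of the restraint strength K. -/
open Matrix

/-- Let `H` be symmetric positive definite with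
`c₀|v|² ≤ vᵀHv ≤ |v|²` for all `v` (where `c₀ ∈ (0,1]`), let `|l| = 1` and `K > 0`, and set
`H_K := H + K llᵀ`. Then `K²/(1+K)² ≤ K²|H_K⁻¹l|² ≤ 1/c₀²`, so the asymptotic variance
`σ_f² = 2K²|H_K⁻¹l|²` of the umbrella observable is bounded above and below by positive
constants independent of the restraint strength `K`. -/
theorem stmt15 (N : ℕ) (H : Matrix (Fin N) (Fin N) ℝ) (hH : H.PosDef)
    (c₀ : ℝ) (hc₀ : 0 < c₀) (hc₀1 : c₀ ≤ 1)
    (hspec : ∀ v : Fin N → ℝ,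
      c₀ * (v ⬝ᵥ v) ≤ v ⬝ᵥ H.mulVec v ∧ v ⬝ᵥ H.mulVec v ≤ v ⬝ᵥ v)
    (l : Fin N → ℝ) (hl : l ⬝ᵥ l = 1) (K : ℝ) (hK : 0 < K)
    (HK : Matrix (Fin N) (Fin N) ℝ) (hHK : HK = H + K • Matrix.vecMulVec l l) :
    K ^ 2 / (1 + K) ^ 2 ≤ K ^ 2 * (HK⁻¹.mulVec l ⬝ᵥ HK⁻¹.mulVec l) ∧
    K ^ 2 * (HK⁻¹.mulVec l ⬝ᵥ HK⁻¹.mulVec l) ≤ 1 / c₀ ^ 2 := by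
  have hps : (Matrix.vecMulVec l l).PosSemidef := by
    have := Matrix.posSemidef_vecMulVec_self_star l
    simpa using this
  have hpd : HK.PosDef := by
    rw [hHK]
    exact hH.add_posSemidef (hps.smul hK.le)
  have hu : IsUnit HK.det := (Matrix.isUnit_iff_isUnit_det _).1 hpd.isUnit
  have hw : HK.mulVec (HK⁻¹.mulVec l) = l := by
    rw [Matrix.mulVec_mulVec, Matrix.mul_nonsing_inv _ hu, Matrix.one_mulVec]
  generalize HK⁻¹.mulVec l = w at hw ⊢
  obtain ⟨a, ha⟩ : ∃ a, a = l ⬝ᵥ w := ⟨_, rfl⟩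
  obtain ⟨s, hs⟩ : ∃ s, s = w ⬝ᵥ w := ⟨_, rfl⟩
  obtain ⟨t, ht⟩ : ∃ t, t = 1 - K * a := ⟨_, rfl⟩
  have hwl : w ⬝ᵥ l = a := by rw [ha, dotProduct_comm]
  have hHw : H.mulVec w = t • l := by
    have h1 : H.mulVec w + (K * a) • l = l := by
      rw [hHK, Matrix.add_mulVec, Matrix.smul_mulVec, Matrix.vecMulVec_mulVec] at hw
      rw [← ha] at hw
      simpa [smul_smul] using hw
    rw [ht, sub_smul, one_smul]
    exact eq_sub_of_add_eq h1
  have hsym : w ⬝ᵥ H.mulVec l = t := by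
    have hT : Hᵀ = H := by simpa using hH.isHermitian.eq
    rw [Matrix.dotProduct_mulVec, ← Matrix.mulVec_transpose, hT, hHw, smul_dotProduct, hl]
    simp
  have hw0 : w ≠ 0 := by
    rintro rfl
    rw [Matrix.mulVec_zero] at hw
    rw [← hw] at hl
    simp at hl
  have hspos : 0 < s := by
    rw [hs]
    have := Matrix.dotProduct_star_self_pos_iff.2 hw0
    simpa using this
  have h1 : c₀ * s ≤ t * a := by
    have := (hspec w).1
    rwa [hHw, dotProduct_smul, hwl, ← hs, smul_eq_mul] at this
  have hta : 0 < t * a := lt_of_lt_of_le (by positivity) h1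
  have hapos : 0 < a := by
    by_contra h
    have : a < 0 := by
      rcases lt_or_eq_of_le (not_lt.1 h) with h | h
      · exact h
      · simp [h] at hta
    have h3 : 0 < t := by rw [ht]; nlinarith
    nlinarith
  have htpos : 0 < t := pos_of_mul_pos_left hta hapos.le
  have h2 : t ≤ a := by
    have hq := (hspec (a • l - w)).1
    have hn : 0 ≤ (a • l - w) ⬝ᵥ (a • l - w) := by
      exact Finset.sum_nonneg fun i _ => mul_self_nonneg _
    have hl1 := (hspec l).2
    rw [hl] at hl1
    have e : (a • l - w) ⬝ᵥ H.mulVec (a • l - w) = a ^ 2 * (l ⬝ᵥ H.mulVec l) - a * t := by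
      rw [Matrix.mulVec_sub, Matrix.mulVec_smul]
      simp only [sub_dotProduct, dotProduct_sub, smul_dotProduct, dotProduct_smul, hHw, hsym, hwl,
        hl, smul_eq_mul]
      ring
    rw [e] at hq
    have := mul_nonneg hc₀.le hn
    nlinarith [mul_le_mul_of_nonneg_left hl1 (sq_nonneg a)]
  have h3 : a ^ 2 ≤ s := by
    have hn : 0 ≤ (a • l - w) ⬝ᵥ (a • l - w) := by
      exact Finset.sum_nonneg fun i _ => mul_self_nonneg _
    simp only [sub_dotProduct, dotProduct_sub, smul_dotProduct, dotProduct_smul, hwl,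
        hl, smul_eq_mul, ← ha, ← hs] at hn
    nlinarith
  rw [← hs]
  constructor
  · have h4 : 1 ≤ (1 + K) * a := by nlinarith
    rw [div_le_iff₀ (by positivity)]
    have h5 : 1 ≤ (1 + K) ^ 2 * s := by
      have : 1 ≤ ((1 + K) * a) ^ 2 := one_le_pow₀ h4
      nlinarith [mul_le_mul_of_nonneg_left h3 (sq_nonneg (1 + K))]
    nlinarith [mul_le_mul_of_nonneg_left h5 (sq_nonneg K)]
  · rw [le_div_iff₀ (by positivity)]
    have hKa : K * a ≤ 1 := by linarith
    have hKt : K * t ≤ 1 := le_trans (mul_le_mul_of_nonneg_left h2 hK.le) hKa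
    have h6 : (K * t) * (K * a) ≤ 1 := mul_le_one₀ hKt (by positivity) hKa
    have h7 : K ^ 2 * (c₀ * s) ≤ 1 := by
      nlinarith [mul_le_mul_of_nonneg_left h1 (sq_nonneg K)]
    calc K ^ 2 * s * c₀ ^ 2 = K ^ 2 * (c₀ * s) * c₀ := by ring
      _ ≤ 1 := mul_le_one₀ h7 hc₀.le hc₀1
end

section
/- Let H be a symmetric positive definite N×N real matrix with vᵀHv ≤ |v|² for every v, let l ∈ ℝ^N with |l| = 1, K > 0, and set H_K := H + K·l·lᵀ. Then K²/(1+K) ≤ K²·lᵀH_K⁻¹l ≤ K. In particular K²·lᵀH_K⁻¹l grows linearly in K as K → ∞, so the asymptotic variance σ_{f,P}² ≈ 2K²·lᵀH_K⁻¹l of the umbrella observable under the Langevin dynamics preconditioned by P_K = P + K l lᵀ deteriorates by a factor of order 1 + K relative to the K-uniformly bounded unpreconditioned variance. -/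
open Matrix

/-- Let `H` be symmetric positive definite with `vᵀHv ≤ |v|²` for all
`v`, let `|l| = 1`, `K > 0`, and set `H_K := H + K llᵀ`. Then
`K²/(1+K) ≤ K² lᵀH_K⁻¹l ≤ K`; in particular `K² lᵀH_K⁻¹l` grows linearly in `K`, so the
asymptotic variance `σ_{f,P}² ≈ 2K² lᵀH_K⁻¹l` of the umbrella observable under the
`P_K = P + K llᵀ` preconditioned dynamics deteriorates by a factor of order `1 + K`. -/
theorem stmt16 (N : ℕ) (H : Matrix (Fin N) (Fin N) ℝ) (hH : H.PosDef)
    (hspec : ∀ v : Fin N → ℝ, v ⬝ᵥ H.mulVec v ≤ v ⬝ᵥ v)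
    (l : Fin N → ℝ) (hl : l ⬝ᵥ l = 1) (K : ℝ) (hK : 0 < K)
    (HK : Matrix (Fin N) (Fin N) ℝ) (hHK : HK = H + K • Matrix.vecMulVec l l) :
    K ^ 2 / (1 + K) ≤ K ^ 2 * (l ⬝ᵥ HK⁻¹.mulVec l) ∧
    K ^ 2 * (l ⬝ᵥ HK⁻¹.mulVec l) ≤ K := by
  have hq : ∀ v : Fin N → ℝ, v ⬝ᵥ HK.mulVec v = v ⬝ᵥ H.mulVec v + K * (l ⬝ᵥ v) ^ 2 := by
    intro v
    rw [hHK, Matrix.add_mulVec, Matrix.smul_mulVec, Matrix.vecMulVec_mulVec, dotProduct_add,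
      dotProduct_smul]
    simp [dotProduct_smul, dotProduct_comm v l]
    left
    ring
  have hps : (K • Matrix.vecMulVec l l).PosSemidef := by
    have h := (Matrix.posSemidef_vecMulVec_self_star l).smul hK.le
    simpa using h
  have hPD : HK.PosDef := by
    rw [hHK]; exact hH.add_posSemidef hps
  have hdet : IsUnit HK.det := hPD.det_pos.ne'.isUnit
  have hnn : ∀ v : Fin N → ℝ, 0 ≤ v ⬝ᵥ H.mulVec v := by
    intro v
    simpa using hH.posSemidef.dotProduct_mulVec_nonneg v
  have hnnK : ∀ v : Fin N → ℝ, 0 ≤ v ⬝ᵥ HK.mulVec v := by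
    intro v
    simpa using hPD.posSemidef.dotProduct_mulVec_nonneg v
  have hsymm : HKᵀ = HK := by simpa using hPD.isHermitian.eq
  set x := HK⁻¹.mulVec l with hx
  have hxl : HK.mulVec x = l := by
    rw [hx, Matrix.mulVec_mulVec, Matrix.mul_nonsing_inv _ hdet, Matrix.one_mulVec]
  set s := l ⬝ᵥ x with hs
  have h1 : s = x ⬝ᵥ H.mulVec x + K * s ^ 2 := by
    have := hq x
    rw [hxl, dotProduct_comm x l] at this
    exact this
  have h2 := hnn x
  have hxHl : x ⬝ᵥ HK.mulVec l = 1 := by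
    rw [Matrix.dotProduct_mulVec, ← Matrix.mulVec_transpose, hsymm, hxl, hl]
  have h3 : l ⬝ᵥ HK.mulVec l ≤ 1 + K := by
    have := hspec l
    rw [hq l, hl] at *
    linarith
  have hxx : x ⬝ᵥ l = s := dotProduct_comm _ _
  have h4 := hnnK (x - (1 / (1 + K)) • l)
  rw [Matrix.mulVec_sub, Matrix.mulVec_smul, hxl, sub_dotProduct, dotProduct_sub,
    dotProduct_sub, smul_dotProduct, smul_dotProduct, dotProduct_smul, dotProduct_smul,
    hxHl, hl, hxx] at h4
  simp only [smul_eq_mul] at h4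
  have hpos : 0 < 1 + K := by linarith
  have h5 : 1 / (1 + K) ≤ s := by
    have e : (1 / (1 + K)) * ((1 / (1 + K)) * (l ⬝ᵥ HK.mulVec l)) ≤ 1 / (1 + K) := by
      have : (1 / (1 + K)) * (l ⬝ᵥ HK.mulVec l) ≤ 1 := by
        rw [one_div, inv_mul_le_iff₀ hpos]; linarith
      have h0 : 0 ≤ 1 / (1 + K) := by positivity
      nlinarith
    linarith
  have hs0 : 0 < s := lt_of_lt_of_le (by positivity) h5
  have h6 : K * s ≤ 1 := by
    by_contra hc
    push Not at hc
    nlinarith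
  constructor
  · have := mul_le_mul_of_nonneg_left h5 (sq_nonneg K)
    rwa [mul_one_div] at this
  · nlinarith
end

section
/- Let N ≥ 2, 1 ≤ i < N, and let P be the N×N one-dimensional discrete Dirichlet Laplacian (P_{nn} = 2, P_{n,n±1} = −1, zero otherwise). Let l := e_i − e_{i+1} be the bond vector of the bond between sites i and i+1. Then |P⁻¹l|² = (Σ_{n=1}^{i} n² + Σ_{n=1}^{N−i} n²)/(N+1)². In particular, for the central bond in a chain of even length N = 2i, |P⁻¹l|² = i(i+1)/(3(2i+1)), which grows linearly in N (asymptotically N/12), so in one dimension the asymptotic variance of the bond-length observable under unpreconditioned Langevin dynamics diverges linearly with system size. -/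
open Matrix Finset

def lapU (N : ℕ) : Matrix (Fin N) (Fin N) ℝ := Matrix.of fun n m : Fin N =>
      if (n : ℕ) = (m : ℕ) then (2 : ℝ)
      else if (n : ℕ) + 1 = (m : ℕ) ∨ (m : ℕ) + 1 = (n : ℕ) then -1 else 0

lemma lapU_mulVec (N : ℕ) (u : ℕ → ℝ) (h0 : u 0 = 0) (h1 : u (N + 1) = 0) (n : Fin N) :
    (lapU N *ᵥ fun m : Fin N => u ((m : ℕ) + 1)) n
      = 2 * u ((n : ℕ) + 1) - u n - u ((n : ℕ) + 2) := by
  obtain ⟨n, hn⟩ := n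
  simp only [lapU, Matrix.mulVec, dotProduct, Matrix.of_apply]
  rw [Fin.sum_univ_eq_sum_range (fun m : ℕ => (if n = m then (2 : ℝ)
      else if n + 1 = m ∨ m + 1 = n then -1 else 0) * u (m + 1)) N]
  have key : ∀ m ∈ Finset.range N, (if n = m then (2 : ℝ)
      else if n + 1 = m ∨ m + 1 = n then -1 else 0) * u (m + 1)
      = (if n = m then 2 * u (m + 1) else 0) - (if m + 1 = n then u (m + 1) else 0)
        - (if n + 1 = m then u (m + 1) else 0) := by
    intro m _
    split_ifs <;> first | omega | ring
  rw [Finset.sum_congr rfl key, Finset.sum_sub_distrib, Finset.sum_sub_distrib,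
    Finset.sum_ite_eq, Finset.sum_ite_eq]
  have e2 : ∑ m ∈ Finset.range N, (if m + 1 = n then u (m + 1) else 0) = u n := by
    cases n with
    | zero => simp [h0]
    | succ k =>
      have : k < N := by omega
      simp [this]
  rw [e2]
  have e3 : (if n + 1 ∈ Finset.range N then u (n + 1 + 1) else 0) = u (n + 2) := by
    split_ifs with h
    · rfl
    · have : n + 2 = N + 1 := by
        simp at h
        omega
      rw [this, h1]
  rw [e3]
  simp [hn]

lemma lapU_isUnit (N : ℕ) : IsUnit (lapU N).det := by
  let g : ℕ → ℕ → ℝ := fun m k =>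
    if k ≤ m + 1 then (k : ℝ) * (N - m) / (N + 1) else (m + 1 : ℝ) * (N + 1 - k) / (N + 1)
  let G : Matrix (Fin N) (Fin N) ℝ := Matrix.of fun k m => g m ((k : ℕ) + 1)
  have hN : (N : ℝ) + 1 ≠ 0 := by positivity
  have h : lapU N * G = 1 := by
    ext n m
    have h2 : (lapU N * G) n m = (lapU N *ᵥ fun k : Fin N => g m ((k : ℕ) + 1)) n := rfl
    rw [h2, lapU_mulVec]
    · obtain ⟨n, hn⟩ := n
      obtain ⟨m, hm⟩ := m
      simp only [g, Matrix.one_apply, Fin.mk.injEq]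
      rcases lt_trichotomy n m with h | h | h
      · rw [if_pos (by omega), if_pos (by omega), if_pos (by omega), if_neg (by omega)]
        push_cast
        ring
      · subst h
        rw [if_pos (by omega), if_pos (by omega), if_neg (by omega), if_pos rfl]
        push_cast
        field_simp
        ring
      · rw [if_neg (by omega), if_neg (by omega : ¬ n + 2 ≤ m + 1), if_neg (by omega : ¬ n = m)]
        by_cases h3 : n = m + 1
        · subst h3
          simp
          ring
        · rw [if_neg (by omega)]
          push_cast
          ring
    · simp [g]
    · have := m.2
      simp only [g]
      rw [if_neg (by omega)]
      simp
  exact Matrix.isUnit_det_of_right_inverse h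

lemma sum_sq_U (i : ℕ) : ∑ n ∈ Finset.range (i + 1), (n : ℝ) ^ 2
    = i * (i + 1) * (2 * i + 1) / 6 := by
  induction i with
  | zero => simp
  | succ k ih =>
    rw [Finset.sum_range_succ, ih]
    push_cast
    ring

lemma sum_rev_U (d : ℕ) : ∑ k ∈ Finset.range d, ((d : ℝ) - k) ^ 2
    = ∑ n ∈ Finset.range (d + 1), (n : ℝ) ^ 2 := by
  induction d with
  | zero => simp
  | succ d ih =>
    rw [Finset.sum_range_succ', Finset.sum_range_succ _ (d + 1), ← ih]
    simp

/-- Let `P` be the `N×N` one-dimensional discrete Dirichlet Laplacian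
and, for `1 ≤ i < N`, let `l := e_i - e_{i+1}` be the bond vector of the bond between
(1-based) sites `i` and `i+1` (in the 0-based indexing used here, `l` is `1` at index
`i-1` and `-1` at index `i`). Then
`|P⁻¹l|² = (Σ_{n=1}^{i} n² + Σ_{n=1}^{N-i} n²)/(N+1)²`; in particular, for the central
bond in a chain of even length `N = 2i`, `|P⁻¹l|² = i(i+1)/(3(2i+1))`, which grows
linearly in `N`. -/
theorem stmt19 (N i : ℕ) (hN : 2 ≤ N) (hi1 : 1 ≤ i) (hiN : i < N)
    (P : Matrix (Fin N) (Fin N) ℝ)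
    (hP : P = Matrix.of fun n m : Fin N =>
      if (n : ℕ) = (m : ℕ) then (2 : ℝ)
      else if (n : ℕ) + 1 = (m : ℕ) ∨ (m : ℕ) + 1 = (n : ℕ) then -1 else 0)
    (l : Fin N → ℝ)
    (hl : l = fun n : Fin N =>
      if (n : ℕ) = i - 1 then (1 : ℝ) else if (n : ℕ) = i then -1 else 0) :
    (P⁻¹.mulVec l ⬝ᵥ P⁻¹.mulVec l) =
      ((∑ n ∈ Finset.range (i + 1), (n : ℝ) ^ 2) +
        ∑ n ∈ Finset.range (N - i + 1), (n : ℝ) ^ 2) / ((N : ℝ) + 1) ^ 2 ∧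
    (N = 2 * i →
      (P⁻¹.mulVec l ⬝ᵥ P⁻¹.mulVec l) =
        (i : ℝ) * ((i : ℝ) + 1) / (3 * (2 * (i : ℝ) + 1))) := by
  have hPl : P = lapU N := hP
  let u : ℕ → ℝ := fun k => if k ≤ i then (k : ℝ) / (N + 1) else -((N : ℝ) + 1 - k) / (N + 1)
  have hN0 : (N : ℝ) + 1 ≠ 0 := by positivity
  have hx : P.mulVec (fun m : Fin N => u ((m : ℕ) + 1)) = l := by
    ext n
    rw [hPl, lapU_mulVec, hl]
    · obtain ⟨n, hn⟩ := n
      simp only [u]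
      split_ifs <;> first | omega | skip
      all_goals
        first
          | (push_cast; ring; done)
          | (push_cast; field_simp; ring; done)
          | (have e : n = i := by omega
             subst e; push_cast; field_simp; ring; done)
    · simp [u]
    · simp only [u]
      rw [if_neg (by omega)]
      simp
  have hinv : P⁻¹.mulVec l = fun m : Fin N => u ((m : ℕ) + 1) := by
    rw [← hx, Matrix.mulVec_mulVec, hPl, Matrix.nonsing_inv_mul _ (lapU_isUnit N),
      Matrix.one_mulVec]
  have main : (P⁻¹.mulVec l ⬝ᵥ P⁻¹.mulVec l) =
      ((∑ n ∈ Finset.range (i + 1), (n : ℝ) ^ 2) +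
        ∑ n ∈ Finset.range (N - i + 1), (n : ℝ) ^ 2) / ((N : ℝ) + 1) ^ 2 := by
    rw [hinv]
    simp only [dotProduct]
    rw [Fin.sum_univ_eq_sum_range (fun m : ℕ => u (m + 1) * u (m + 1)) N]
    obtain ⟨d, rfl⟩ := Nat.exists_eq_add_of_le hiN.le
    rw [Finset.sum_range_add, Nat.add_sub_cancel_left, ← sum_rev_U d, add_div,
      Finset.sum_range_succ' _ i, Finset.sum_div]
    congr 1
    · rw [Nat.cast_zero, zero_pow two_ne_zero, add_zero, Finset.sum_div]
      refine Finset.sum_congr rfl fun k hk => ?_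
      have := Finset.mem_range.1 hk
      simp only [u]
      rw [if_pos (by omega)]
      field_simp
    · refine Finset.sum_congr rfl fun k hk => ?_
      simp only [u]
      rw [if_neg (by omega)]
      push_cast
      field_simp
      ring
  refine ⟨main, fun h => ?_⟩
  rw [main]
  subst h
  have : 2 * i - i = i := by omega
  rw [this, sum_sq_U]
  have h3 : 2 * (i : ℝ) + 1 ≠ 0 := by positivity
  push_cast
  field_simp
  ring
end
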